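/- arXiv:2202.12046 — 5 statements merged into one kernel-verified Lean document; each statement's English description precedes it below -/
import Mathlib

section
/- Let I be an independent family of subsets of ℕ. Then I is densely maximal if and only if every subset X of ℕ either belongs to fil(I) or satisfies X ⊆* ℕ∖I^g for some g ∈ FF(I) (that is, P(ℕ) equals the union of fil(I) with the downward ⊆*-closure of the family {ℕ∖I^g : g ∈ FF(I)}). -/
/-- Finite partial functions from `I` to `{0,1}` (encoded as `Set ℕ → Option Bool`). -/
def FF (I : Set (Set ℕ)) : Set (Set ℕ → Option Bool) :=
  {g | {A : Set ℕ | g A ≠ none}.Finite ∧ ∀ A : Set ℕ, g A ≠ none → A ∈ I}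

/-- `g` extends `g'` as a partial function. -/
def FFExtends (g g' : Set ℕ → Option Bool) : Prop :=
  ∀ (A : Set ℕ) (b : Bool), g' A = some b → g A = some b

/-- The boolean combination `I^g`: intersection of the sets mapped to `1`
and complements of the sets mapped to `0` (so `I^∅ = ℕ`). -/
def boolComb (g : Set ℕ → Option Bool) : Set ℕ :=
  {n | ∀ A : Set ℕ, (g A = some true → n ∈ A) ∧ (g A = some false → n ∉ A)}

/-- `I` is an independent family. -/
def IndepFam (I : Set (Set ℕ)) : Prop :=
  (∀ A ∈ I, A.Infinite) ∧ ∀ g ∈ FF I, (boolComb g).Infinite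

/-- The density filter `fil(I)`. -/
def densityFil (I : Set (Set ℕ)) : Set (Set ℕ) :=
  {X | ∀ g' ∈ FF I, ∃ g ∈ FF I, FFExtends g g' ∧ (boolComb g \ X).Finite}

/-- The density ideal `id(I)`. -/
def densityIdl (I : Set (Set ℕ)) : Set (Set ℕ) :=
  {X | ∀ g' ∈ FF I, ∃ g ∈ FF I, FFExtends g g' ∧ (boolComb g ∩ X).Finite}

/-- `I` is densely maximal. -/
def DenselyMaximal (I : Set (Set ℕ)) : Prop :=
  ∀ X : Set ℕ, X.Infinite → ∀ g' ∈ FF I, ∃ g ∈ FF I, FFExtends g g' ∧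
    ((boolComb g ∩ X).Finite ∨ (boolComb g \ X).Finite)

theorem boolComb_subset_of_extends {g g' : Set ℕ → Option Bool} (h : FFExtends g g') :
    boolComb g ⊆ boolComb g' :=
  fun _ hn A => ⟨fun hA => (hn A).1 (h A _ hA), fun hA => (hn A).2 (h A _ hA)⟩

theorem none_mem_FF (I : Set (Set ℕ)) : (fun _ => none) ∈ FF I := by
  simp [FF]

theorem or_mem_FF {I : Set (Set ℕ)} {g h : Set ℕ → Option Bool} (hg : g ∈ FF I)
    (hh : h ∈ FF I) : (fun A => (g A).or (h A)) ∈ FF I := by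
  have key : ∀ A : Set ℕ, (g A).or (h A) ≠ none → g A ≠ none ∨ h A ≠ none := by
    intro A hA
    by_contra! hc
    exact hA (by simp [hc.1, hc.2])
  exact ⟨(hg.1.union hh.1).subset key, fun A hA => (key A hA).elim (hg.2 A) (hh.2 A)⟩

theorem extends_or_left (g h : Set ℕ → Option Bool) :
    FFExtends (fun A => (g A).or (h A)) g := by
  intro A b hA
  simp [hA]

/-- If the Boolean combinations of `g` and `h` meet, then `g ∪ h` is a partial function. -/
theorem extends_or_right {g h : Set ℕ → Option Bool} {n : ℕ} (hg : n ∈ boolComb g)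
    (hh : n ∈ boolComb h) : FFExtends (fun A => (g A).or (h A)) h := by
  intro A b hA
  have h1 := hg A
  have h2 := hh A
  rcases hgA : g A with _ | c
  · simp [hgA, hA]
  · cases b <;> cases c <;> simp_all

/-- An independent family `I` is densely maximal iff every `X ⊆ ℕ` either belongs to
`fil(I)` or satisfies `X ⊆* ℕ∖I^g` for some `g ∈ FF(I)`. -/
theorem denselyMaximal_iff_fil_union_dn (I : Set (Set ℕ)) (hI : IndepFam I) :
    DenselyMaximal I ↔
      ∀ X : Set ℕ, X ∈ densityFil I ∨ ∃ g ∈ FF I, (X \ (boolComb g)ᶜ).Finite := by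
  constructor
  · intro hmax X
    by_contra! hX
    obtain ⟨hfil, hdn⟩ := hX
    have hmeet : ∀ g ∈ FF I, ¬(boolComb g ∩ X).Finite := fun g hg hfin =>
      hdn g hg (hfin.subset fun n hn => ⟨not_not.1 hn.2, hn.1⟩)
    have hinf : X.Infinite := fun hfin =>
      hmeet _ (none_mem_FF I) (hfin.subset Set.inter_subset_right)
    refine hfil fun g' hg' => ?_
    obtain ⟨g, hg, hext, hfin | hfin⟩ := hmax X hinf g' hg'
    · exact absurd hfin (hmeet g hg)
    · exact ⟨g, hg, hext, hfin⟩
  · intro hcover X _ g' hg'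
    rcases hcover (X ∪ (boolComb g')ᶜ) with hfil | ⟨h, hh, hfin⟩
    · obtain ⟨g, hg, hext, hfin⟩ := hfil g' hg'
      refine ⟨g, hg, hext, Or.inr (hfin.subset fun n hn => ⟨hn.1, ?_⟩)⟩
      rintro (hX | hc)
      · exact hn.2 hX
      · exact hc (boolComb_subset_of_extends hext hn.1)
    · obtain ⟨n, hn, hn'⟩ : ∃ n, n ∈ boolComb g' ∧ n ∈ boolComb h := by
        by_contra! hdisj
        exact hI.2 h hh (hfin.subset fun n hn =>
          ⟨Or.inr fun hng => hdisj n hng hn, not_not.2 hn⟩)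
      refine ⟨_, or_mem_FF hg' hh, extends_or_left g' h, Or.inl (hfin.subset fun m hm => ?_)⟩
      exact ⟨Or.inl hm.2, not_not.2 (boolComb_subset_of_extends (extends_or_right hn hn') hm.1)⟩
end

section
/- Let I be an infinite independent family of subsets of ℕ. Then: (a) X ∈ fil(I) if and only if for every g' ∈ FF(I) there is g ∈ FF(I) with g ⊇ g' and I^g ∖ X = ∅; (b) X ∈ id(I) if and only if for every g' ∈ FF(I) there is g ∈ FF(I) with g ⊇ g' and I^g ∩ X = ∅; (c) I is densely maximal if and only if for every infinite X ⊆ ℕ and every g' ∈ FF(I) there is g ∈ FF(I) with g ⊇ g' such that I^g ∩ X = ∅ or I^g ∖ X = ∅. -/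
theorem FFExtends.trans {f g h : Set ℕ → Option Bool} (hfg : FFExtends f g)
    (hgh : FFExtends g h) : FFExtends f h :=
  fun A b hA => hfg A b (hgh A b hA)

theorem boolComb_subset_of_FFExtends {h g : Set ℕ → Option Bool} (hhg : FFExtends h g) :
    boolComb h ⊆ boolComb g :=
  fun _ hn A => ⟨fun hA => (hn A).1 (hhg A _ hA), fun hA => (hn A).2 (hhg A _ hA)⟩

/-- An unused member of an infinite family can be decided so as to exclude a given point. -/
theorem exists_FFExtends_notMem_boolComb {I : Set (Set ℕ)} (hinf : I.Infinite)
    {g : Set ℕ → Option Bool} (hg : g ∈ FF I) (n : ℕ) :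
    ∃ h ∈ FF I, FFExtends h g ∧ n ∉ boolComb h := by
  classical
  obtain ⟨B, hBI, hB⟩ := hinf.exists_notMem_finite hg.1
  have hgB : g B = none := by simpa using hB
  refine ⟨Function.update g B (some (decide (n ∉ B))), ⟨?_, ?_⟩, ?_, ?_⟩
  · refine (hg.1.insert B).subset fun A hA => ?_
    by_cases hAB : A = B
    · exact Or.inl hAB
    · exact Or.inr (by simpa [Function.update_of_ne hAB] using hA)
  · intro A hA
    by_cases hAB : A = B
    · exact hAB ▸ hBI
    · exact hg.2 A (by simpa [Function.update_of_ne hAB] using hA)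
  · intro A b hA
    have hAB : A ≠ B := by
      rintro rfl
      simp [hgB] at hA
    rwa [Function.update_of_ne hAB]
  · intro hn
    have hnB := hn B
    by_cases h : n ∈ B <;> simp [h] at hnB

theorem exists_FFExtends_boolComb_inter_eq_empty {I : Set (Set ℕ)} (hinf : I.Infinite)
    {g : Set ℕ → Option Bool} (hg : g ∈ FF I) {F : Set ℕ} (hF : F.Finite) :
    ∃ h ∈ FF I, FFExtends h g ∧ boolComb h ∩ F = ∅ := by
  induction F, hF using Set.Finite.induction_on with
  | empty => exact ⟨g, hg, fun _ _ => id, Set.inter_empty _⟩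
  | @insert n F _ _ ih =>
    obtain ⟨h, hh, hhg, hhF⟩ := ih
    obtain ⟨k, hk, hkh, hnk⟩ := exists_FFExtends_notMem_boolComb hinf hh n
    refine ⟨k, hk, hkh.trans hhg, ?_⟩
    rw [Set.inter_insert_of_notMem hnk]
    exact Set.subset_eq_empty
      (Set.inter_subset_inter_left F (boolComb_subset_of_FFExtends hkh)) hhF

/-- A finite trace of a boolean combination becomes empty after a further extension. -/
theorem exists_FFExtends_inter_eq_empty_of_finite {I : Set (Set ℕ)} (hinf : I.Infinite)
    {g g' : Set ℕ → Option Bool} (hg : g ∈ FF I) (hgg' : FFExtends g g') {Y : Set ℕ}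
    (hY : (boolComb g ∩ Y).Finite) :
    ∃ h ∈ FF I, FFExtends h g' ∧ boolComb h ∩ Y = ∅ := by
  obtain ⟨h, hh, hhg, hhY⟩ := exists_FFExtends_boolComb_inter_eq_empty hinf hg hY
  refine ⟨h, hh, hhg.trans hgg', ?_⟩
  rwa [← Set.inter_assoc, Set.inter_eq_left.2 (boolComb_subset_of_FFExtends hhg)] at hhY

/-- For an infinite independent family, "finite" can be replaced by "empty" in the
definitions of the density filter, density ideal and dense maximality. -/
theorem finite_iff_empty_for_infinite_indep (I : Set (Set ℕ)) (hinf : I.Infinite)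
    (hI : IndepFam I) :
    (∀ X : Set ℕ, X ∈ densityFil I ↔
        ∀ g' ∈ FF I, ∃ g ∈ FF I, FFExtends g g' ∧ boolComb g \ X = ∅) ∧
    (∀ X : Set ℕ, X ∈ densityIdl I ↔
        ∀ g' ∈ FF I, ∃ g ∈ FF I, FFExtends g g' ∧ boolComb g ∩ X = ∅) ∧
    (DenselyMaximal I ↔
        ∀ X : Set ℕ, X.Infinite → ∀ g' ∈ FF I, ∃ g ∈ FF I, FFExtends g g' ∧
          (boolComb g ∩ X = ∅ ∨ boolComb g \ X = ∅)) := by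
  have key {g g' : Set ℕ → Option Bool} (hg : g ∈ FF I) (hgg' : FFExtends g g') (Y : Set ℕ) :=
    exists_FFExtends_inter_eq_empty_of_finite hinf hg hgg' (Y := Y)
  refine ⟨fun X => ⟨fun hX g' hg' => ?_, fun hX g' hg' => ?_⟩,
    fun X => ⟨fun hX g' hg' => ?_, fun hX g' hg' => ?_⟩,
    fun hM X hX g' hg' => ?_, fun hM X hX g' hg' => ?_⟩
  · obtain ⟨g, hg, hgg', hfin⟩ := hX g' hg'
    exact key hg hgg' Xᶜ hfin
  · obtain ⟨g, hg, hgg', hemp⟩ := hX g' hg'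
    exact ⟨g, hg, hgg', hemp ▸ Set.finite_empty⟩
  · obtain ⟨g, hg, hgg', hfin⟩ := hX g' hg'
    exact key hg hgg' X hfin
  · obtain ⟨g, hg, hgg', hemp⟩ := hX g' hg'
    exact ⟨g, hg, hgg', hemp ▸ Set.finite_empty⟩
  · obtain ⟨g, hg, hgg', hfin | hfin⟩ := hM X hX g' hg'
    · obtain ⟨h, hh, hhg', hemp⟩ := key hg hgg' X hfin
      exact ⟨h, hh, hhg', Or.inl hemp⟩
    · obtain ⟨h, hh, hhg', hemp⟩ := key hg hgg' Xᶜ hfin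
      exact ⟨h, hh, hhg', Or.inr hemp⟩
  · obtain ⟨g, hg, hgg', hemp⟩ := hM X hX g' hg'
    refine ⟨g, hg, hgg', hemp.imp (fun h => ?_) (fun h => ?_)⟩ <;>
      exact h ▸ Set.finite_empty
end

section
/- Let F be a filter on ℕ such that every member of F is infinite, F is closed under finite modifications, and F is a Q-set. Then for every C ∈ F and every strictly increasing function f : ℕ → ℕ there is C* ∈ F with C* ⊆ C such that, letting {k_n : n ∈ ℕ} be the strictly increasing enumeration of C*, one has f(1) < k_1 and f(k_n) < k_{n+1} for all n. -/
/-- A family `F` of subsets of `ℕ` is a Q-set: for every partition of `ℕ` into finite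
sets `{I_n : n ∈ ℕ}` there is `A ∈ F` with `|A ∩ I_n| ≤ 1` for all `n`. -/
def IsQSet (F : Set (Set ℕ)) : Prop :=
  ∀ I : ℕ → Set ℕ, (∀ n, (I n).Finite) → (∀ m n, m ≠ n → Disjoint (I m) (I n)) →
    (⋃ n, I n) = Set.univ → ∃ A ∈ F, ∀ n, (A ∩ I n).Subsingleton

/-- A Q-set contains a set on which a given finite-to-one function is injective. -/
theorem IsQSet.exists_injOn {F : Set (Set ℕ)} (hF : IsQSet F) (g : ℕ → ℕ)
    (hg : ∀ n, (g ⁻¹' {n}).Finite) : ∃ A ∈ F, A.InjOn g := by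
  obtain ⟨A, hA, h⟩ := hF (fun n => g ⁻¹' {n}) hg
    (fun m n hmn => Disjoint.preimage g (by simpa using hmn))
    (by ext x; simp)
  exact ⟨A, hA, fun x hx y hy hxy => h (g y) ⟨hx, hxy⟩ ⟨hy, rfl⟩⟩

/-- For every strictly increasing `f` there is a monotone finite-to-one `g` such that
`f x < y` whenever `g x + 2 ≤ g y`. -/
theorem exists_monotone_finite_fibers_lt (f : ℕ → ℕ) (hf : StrictMono f) :
    ∃ g : ℕ → ℕ, Monotone g ∧ (∀ n, {x | g x ≤ n}.Finite) ∧
      ∀ x y, g x + 2 ≤ g y → f x < y := by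
  obtain ⟨a, ha_succ⟩ : ∃ a : ℕ → ℕ, ∀ n, a (n + 1) = f (a n) + 1 :=
    ⟨fun n => (fun b => f b + 1)^[n] 0, fun n => Function.iterate_succ_apply' _ n 0⟩
  have ha : StrictMono a := strictMono_nat_of_lt_succ fun n => by
    have := hf.le_apply (x := a n)
    have := ha_succ n
    omega
  have hex (x : ℕ) : ∃ n, x < a n := ⟨x + 1, ha.le_apply (x := x + 1)⟩
  have hlt (x : ℕ) : x < a (Nat.find (hex x)) := Nat.find_spec (hex x)
  refine ⟨fun x => Nat.find (hex x), fun x y hxy => Nat.find_mono fun n hn => hxy.trans_lt hn,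
    fun n => (Set.finite_Iio (a n)).subset fun x hx => (hlt x).trans_le (ha.monotone hx),
    fun x y hxy => ?_⟩
  have hy : a (Nat.find (hex x) + 1) ≤ y := not_lt.mp (Nat.find_min (hex y) hxy)
  have := hf (hlt x)
  have := ha_succ (Nat.find (hex x))
  omega

/-- If `F` is a filter on `ℕ` all of whose members are infinite, closed under finite
modifications, and a Q-set, then for every `C ∈ F` and strictly increasing `f : ℕ → ℕ`
there is `C* ∈ F`, `C* ⊆ C`, whose increasing enumeration `⟨k_n⟩` satisfies
`f(1) < k_1` and `f(k_n) < k_{n+1}` for all `n`. -/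
theorem exists_fast_subset_of_qset (F : Filter ℕ)
    (hinf : ∀ A ∈ F, A.Infinite)
    (hmod : ∀ A ∈ F, ∀ B : Set ℕ, (symmDiff A B).Finite → B ∈ F)
    (hQ : IsQSet {A : Set ℕ | A ∈ F})
    (C : Set ℕ) (hC : C ∈ F) (f : ℕ → ℕ) (hf : StrictMono f) :
    ∃ Cs ∈ F, Cs ⊆ C ∧
      f 1 < Nat.nth (· ∈ Cs) 1 ∧
      ∀ n : ℕ, f (Nat.nth (· ∈ Cs) n) < Nat.nth (· ∈ Cs) (n + 1) := by
  obtain ⟨g, hmono, hfin, hg⟩ := exists_monotone_finite_fibers_lt f hf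
  obtain ⟨A, hA, hAg⟩ := hQ.exists_injOn (fun x => g x / 2) fun n =>
    (hfin (2 * n + 1)).subset fun x (hx : g x / 2 = n) => show g x ≤ 2 * n + 1 by omega
  obtain ⟨B, hB, hBg⟩ := hQ.exists_injOn (fun x => (g x + 1) / 2) fun n =>
    (hfin (2 * n + 1)).subset fun x (hx : (g x + 1) / 2 = n) => show g x ≤ 2 * n + 1 by omega
  have hD : Set.Ioi (f 1) ∈ F := hmod Set.univ Filter.univ_mem _ <|
    (Set.finite_Iic (f 1)).subset fun x hx => by simpa [Set.mem_symmDiff] using hx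
  have hmem : A ∩ B ∩ (C ∩ Set.Ioi (f 1)) ∈ F :=
    Filter.inter_mem (Filter.inter_mem hA hB) (Filter.inter_mem hC hD)
  have hfast : ∀ x ∈ A ∩ B, ∀ y ∈ A ∩ B, x < y → f x < y := by
    intro x hx y hy hxy
    have hle := hmono hxy.le
    have hA_ne : g x / 2 ≠ g y / 2 := fun h => hxy.ne (hAg hx.1 hy.1 h)
    have hB_ne : (g x + 1) / 2 ≠ (g y + 1) / 2 := fun h => hxy.ne (hBg hx.2 hy.2 h)
    exact hg x y (by omega)
  have hk := Nat.nth_mem_of_infinite (hinf _ hmem)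
  have hlt := Nat.nth_strictMono (hinf _ hmem)
  exact ⟨_, hmem, fun x hx => hx.2.1, (hk 1).2.2,
    fun n => hfast _ (hk n).1 _ (hk (n + 1)).1 (hlt (Nat.lt_add_one n))⟩
end

section
/- Let f : ℕ → ℕ be strictly increasing and define a sequence ⟨n_l : l ∈ ℕ⟩ by n_0 = 0 and n_{l+1} = min{n : n_l < n and f(m) < n for all m < n_l}. Suppose C ⊆ ℕ satisfies |C ∩ [n_{3l}, n_{3l+3})| ≤ 1 for every l ∈ ℕ. Then there are no elements m₁ < m₂ < m₃ of C with m₃ ≤ f(m₁). -/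
/-- Let `f` be strictly increasing, `n_0 = 0` and
`n_{l+1} = min {n | n_l < n ∧ ∀ m < n_l, f m < n}`. If `C` meets every interval
`[n_{3l}, n_{3l+3})` in at most one point, then there are no `m₁ < m₂ < m₃` in `C`
with `m₃ ≤ f m₁`. -/
theorem no_three_close_elements (f : ℕ → ℕ) (hf : StrictMono f)
    (n : ℕ → ℕ) (h0 : n 0 = 0)
    (hrec : ∀ l, n (l + 1) = sInf {m : ℕ | n l < m ∧ ∀ k < n l, f k < m})
    (C : Set ℕ) (hC : ∀ l : ℕ, (C ∩ Set.Ico (n (3 * l)) (n (3 * l + 3))).Subsingleton) :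
    ¬ ∃ m₁ m₂ m₃ : ℕ, m₁ ∈ C ∧ m₂ ∈ C ∧ m₃ ∈ C ∧ m₁ < m₂ ∧ m₂ < m₃ ∧ m₃ ≤ f m₁ := by
  have hmem : ∀ l, n l < n (l + 1) ∧ ∀ k < n l, f k < n (l + 1) := by
    intro l
    have hne : {m : ℕ | n l < m ∧ ∀ k < n l, f k < m}.Nonempty :=
      ⟨n l + f (n l) + 1, by omega, fun k hk => by have := hf hk; omega⟩
    rw [hrec l]
    exact Nat.sInf_mem hne
  have hn : StrictMono n := strictMono_nat_of_lt_succ fun l => (hmem l).1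
  rintro ⟨m₁, m₂, m₃, h₁, h₂, h₃, h₁₂, h₂₃, h₁₃⟩
  -- `a` indexes the block containing `m₁`
  obtain ⟨a, ha, ha'⟩ : ∃ a, n (3 * a) ≤ m₁ ∧ m₁ < n (3 * a + 3) := by
    have hb : StrictMono fun l => n (3 * l) := fun i j hij => hn (by omega)
    obtain ⟨a, ha, ha'⟩ := hb.exists_between_of_tendsto_atTop hb.tendsto_atTop
      (x := m₁ + 1) (by simp [h0])
    exact ⟨a, Nat.lt_succ_iff.mp ha, ha'⟩
  have h₃lt : m₃ < n (3 * (a + 1) + 3) :=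
    (h₁₃.trans_lt ((hmem _).2 m₁ ha')).trans (hn (by omega))
  have h₂ge : n (3 * (a + 1)) ≤ m₂ := by
    by_contra! h
    exact h₁₂.ne (hC a ⟨h₁, ha, ha'⟩ ⟨h₂, ha.trans h₁₂.le, h⟩)
  exact h₂₃.ne (hC (a + 1) ⟨h₂, h₂ge, h₂₃.trans h₃lt⟩ ⟨h₃, h₂ge.trans h₂₃.le, h₃lt⟩)
end

section
/- Let h : ℕ → ℕ satisfy 1 < h(n) for all n, and let ⟨p_n : n ∈ ℕ⟩ be a fusion sequence of h-perfect trees, i.e., p_{n+1} ≤_n p_n for all n. Then the intersection ⋂_{n∈ℕ} p_n is an h-perfect tree. -/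
/-- `p` is an `h`-perfect tree: a nonempty set of finite sequences of naturals, closed
under initial segments, with entries bounded by `h`, in which every node has either
exactly one or exactly `h(|t|)` immediate successors, and every node has an extension
with `h(|t'|)` immediate successors. -/
def IsHPerfect (h : ℕ → ℕ) (p : Set (List ℕ)) : Prop :=
  p.Nonempty ∧
  (∀ t ∈ p, ∀ s : List ℕ, s <+: t → s ∈ p) ∧
  (∀ t ∈ p, ∀ i : Fin t.length, t.get i < h i.val) ∧
  (∀ t ∈ p, {m : ℕ | t ++ [m] ∈ p}.ncard = 1 ∨ {m : ℕ | t ++ [m] ∈ p}.ncard = h t.length) ∧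
  (∀ t ∈ p, ∃ t' ∈ p, t <+: t' ∧ {m : ℕ | t' ++ [m] ∈ p}.ncard = h t'.length)

/-- `t` is a splitting node of `p`: it has exactly `h(|t|)` immediate successors. -/
def IsSplitNode (h : ℕ → ℕ) (p : Set (List ℕ)) (t : List ℕ) : Prop :=
  t ∈ p ∧ {m : ℕ | t ++ [m] ∈ p}.ncard = h t.length

/-- `Split_n(p)` (for `n ≥ 1`): splitting nodes with exactly `n - 1` proper initial
segments that are splitting nodes. -/
def SplitN (h : ℕ → ℕ) (p : Set (List ℕ)) (n : ℕ) : Set (List ℕ) :=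
  {t | IsSplitNode h p t ∧
    {s : List ℕ | s <+: t ∧ s ≠ t ∧ IsSplitNode h p s}.ncard = n - 1}

/-- `q ≤_n p`: `q ⊆ p` and `Split_i(q) = Split_i(p)` for all `1 ≤ i ≤ n`. -/
def FusionLE (h : ℕ → ℕ) (q p : Set (List ℕ)) (n : ℕ) : Prop :=
  q ⊆ p ∧ ∀ i : ℕ, 1 ≤ i → i ≤ n → SplitN h q i = SplitN h p i

/-- A node all of whose proper splitting initial segments have length less than `L` has at
most `L` of them. -/
theorem ncard_proper_split_prefixes_le {h : ℕ → ℕ} {p : Set (List ℕ)} {t : List ℕ} {L : ℕ}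
    (hL : ∀ s, s <+: t → s ≠ t → IsSplitNode h p s → s.length < L) :
    {s : List ℕ | s <+: t ∧ s ≠ t ∧ IsSplitNode h p s}.ncard ≤ L := by
  have hle := Set.ncard_le_ncard_of_injOn (s := {s | s <+: t ∧ s ≠ t ∧ IsSplitNode h p s})
    (t := Set.Iio L) List.length (fun s hs => hL s hs.1 hs.2.1 hs.2.2)
    (fun a ha b hb hab =>
      (List.prefix_of_prefix_length_le ha.1 hb.1 hab.le).eq_of_length hab)
    (Set.finite_Iio L)
  simpa [Set.ncard_eq_toFinset_card'] using hle

theorem length_lt_of_prefix_of_ne {s t : List ℕ} (hst : s <+: t) (hne : s ≠ t) :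
    s.length < t.length :=
  lt_of_le_of_ne hst.length_le fun e => hne (hst.eq_of_length e)

theorem IsSplitNode.mem_splitN {h : ℕ → ℕ} {p : Set (List ℕ)} {t : List ℕ}
    (ht : IsSplitNode h p t) :
    t ∈ SplitN h p ({s : List ℕ | s <+: t ∧ s ≠ t ∧ IsSplitNode h p s}.ncard + 1) :=
  ⟨ht, rfl⟩

/-- The immediate successors of a splitting node `t` are all `t ++ [m]` with `m < h |t|`. -/
theorem IsSplitNode.succ_eq {h : ℕ → ℕ} {p : Set (List ℕ)} (hp : IsHPerfect h p) {t : List ℕ}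
    (ht : IsSplitNode h p t) : {m : ℕ | t ++ [m] ∈ p} = Set.Iio (h t.length) := by
  apply Set.eq_of_subset_of_ncard_le _ _ (Set.finite_Iio _)
  · intro m hm
    simpa using hp.2.2.1 _ hm ⟨t.length, by simp⟩
  · rw [ht.2]
    simp [Set.ncard_eq_toFinset_card']

section Fusion

variable {h : ℕ → ℕ} {p : ℕ → Set (List ℕ)}

theorem fusion_antitone (hfus : ∀ n, FusionLE h (p (n + 1)) (p n) n) : Antitone p :=
  antitone_nat_of_succ_le fun n => (hfus n).1

theorem splitN_fusion_eq (hfus : ∀ n, FusionLE h (p (n + 1)) (p n) n) {n m i : ℕ}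
    (hnm : n ≤ m) (hi : 1 ≤ i) (hin : i ≤ n) : SplitN h (p m) i = SplitN h (p n) i := by
  induction m, hnm using Nat.le_induction with
  | base => rfl
  | succ m hm ih => rw [(hfus m).2 i hi (hin.trans hm), ih]

theorem isSplitNode_fusion_of_prefixes (hfus : ∀ n, FusionLE h (p (n + 1)) (p n) n)
    {n m : ℕ} (hnm : n ≤ m) {t : List ℕ} (ht : IsSplitNode h (p n) t)
    (hL : ∀ s, s <+: t → s ≠ t → IsSplitNode h (p n) s → s.length + 1 < n) (hn : 0 < n) :
    IsSplitNode h (p m) t := by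
  have hc := ncard_proper_split_prefixes_le (L := n - 1) fun s h1 h2 h3 =>
    Nat.lt_sub_of_add_lt (hL s h1 h2 h3)
  have hmem := ht.mem_splitN
  rw [← splitN_fusion_eq hfus hnm (by omega) (by omega)] at hmem
  exact hmem.1

theorem isSplitNode_fusion_iff (hfus : ∀ n, FusionLE h (p (n + 1)) (p n) n)
    {n m : ℕ} (hnm : n ≤ m) {t : List ℕ} (ht : t.length < n) :
    IsSplitNode h (p m) t ↔ IsSplitNode h (p n) t := by
  constructor
  · intro hs
    have hc := ncard_proper_split_prefixes_le (h := h) (p := p m)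
      fun s h1 (h2 : s ≠ t) _ => length_lt_of_prefix_of_ne h1 h2
    have hmem := hs.mem_splitN
    rw [splitN_fusion_eq hfus hnm (by omega) (by omega)] at hmem
    exact hmem.1
  · intro hs
    refine isSplitNode_fusion_of_prefixes hfus hnm hs (fun s h1 h2 _ => ?_) (by omega)
    have := length_lt_of_prefix_of_ne h1 h2
    omega

/-- Along a fusion sequence, `p n` and all later trees have the same nodes of length at
most `n`. -/
theorem mem_fusion_of_le (hh : ∀ n, 1 < h n) (hperf : ∀ n, IsHPerfect h (p n))
    (hfus : ∀ n, FusionLE h (p (n + 1)) (p n) n) {n m : ℕ} (hnm : n ≤ m) {t : List ℕ}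
    (hlen : t.length ≤ n) (ht : t ∈ p n) : t ∈ p m := by
  induction t using List.reverseRecOn with
  | nil =>
    obtain ⟨s, hs⟩ := (hperf m).1
    exact (hperf m).2.1 s hs [] List.nil_prefix
  | append_singleton t a ih =>
    have hlt : t.length < n := by simpa using hlen
    have htn : t ∈ p n := (hperf n).2.1 _ ht t (List.prefix_append _ _)
    have htm := ih hlt.le htn
    by_cases hs : IsSplitNode h (p n) t
    · have hs' := (isSplitNode_fusion_iff hfus hnm hlt).2 hs
      have ha : a ∈ {b : ℕ | t ++ [b] ∈ p n} := ht
      rw [hs.succ_eq (hperf n), ← hs'.succ_eq (hperf m)] at ha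
      exact ha
    · have hone := ((hperf n).2.2.2.1 t htn).resolve_right fun e => hs ⟨htn, e⟩
      obtain ⟨c, hc⟩ := Set.ncard_eq_one.1 hone
      have hpos : {b : ℕ | t ++ [b] ∈ p m}.ncard ≠ 0 := by
        have := hh t.length
        rcases (hperf m).2.2.2.1 t htm with e | e <;> omega
      obtain ⟨b, hb⟩ := Set.nonempty_of_ncard_ne_zero hpos
      have hbc : b ∈ {b : ℕ | t ++ [b] ∈ p n} := fusion_antitone hfus hnm hb
      have hac : a ∈ {b : ℕ | t ++ [b] ∈ p n} := ht
      rw [hc, Set.mem_singleton_iff] at hbc hac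
      rw [hac, ← hbc]
      exact hb

theorem mem_iInter_fusion_iff (hh : ∀ n, 1 < h n) (hperf : ∀ n, IsHPerfect h (p n))
    (hfus : ∀ n, FusionLE h (p (n + 1)) (p n) n) {n : ℕ} {t : List ℕ} (hlen : t.length ≤ n) :
    t ∈ ⋂ k, p k ↔ t ∈ p n := by
  refine ⟨fun ht => Set.mem_iInter.1 ht n, fun ht => Set.mem_iInter.2 fun k => ?_⟩
  rcases le_total n k with hk | hk
  · exact mem_fusion_of_le hh hperf hfus hk hlen ht
  · exact fusion_antitone hfus hk ht

theorem succ_iInter_fusion_eq (hh : ∀ n, 1 < h n) (hperf : ∀ n, IsHPerfect h (p n))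
    (hfus : ∀ n, FusionLE h (p (n + 1)) (p n) n) {n : ℕ} {t : List ℕ} (hlen : t.length < n) :
    {m : ℕ | t ++ [m] ∈ ⋂ k, p k} = {m : ℕ | t ++ [m] ∈ p n} := by
  ext m
  exact mem_iInter_fusion_iff hh hperf hfus (by simpa using hlen)

end Fusion

/-- Every node of an `h`-perfect tree has a splitting extension below which every proper
splitting initial segment is a proper initial segment of the node. -/
theorem IsHPerfect.exists_minimal_split {h : ℕ → ℕ} {p : Set (List ℕ)} (hp : IsHPerfect h p)
    {t : List ℕ} (ht : t ∈ p) :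
    ∃ u, t <+: u ∧ IsSplitNode h p u ∧
      ∀ s, s <+: u → s ≠ u → IsSplitNode h p s → s.length < t.length := by
  obtain ⟨v, hv, htv, hvs⟩ := hp.2.2.2.2 t ht
  obtain ⟨u, ⟨htu, hus⟩, hmin⟩ := exists_minimalFor_of_wellFoundedLT
    (fun u => t <+: u ∧ IsSplitNode h p u) List.length ⟨v, htv, hv, hvs⟩
  refine ⟨u, htu, hus, fun s hsu hne hs => ?_⟩
  have hlt := length_lt_of_prefix_of_ne hsu hne
  by_contra hle
  have hts := List.prefix_of_prefix_length_le htu hsu (not_lt.1 hle)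
  exact absurd (hmin ⟨hts, hs⟩ hlt.le) (not_le.2 hlt)

/-- The intersection of a fusion sequence of `h`-perfect trees is an `h`-perfect tree. -/
theorem iInter_fusion_isHPerfect (h : ℕ → ℕ) (hh : ∀ n, 1 < h n)
    (p : ℕ → Set (List ℕ)) (hperf : ∀ n, IsHPerfect h (p n))
    (hfus : ∀ n, FusionLE h (p (n + 1)) (p n) n) :
    IsHPerfect h (⋂ n, p n) := by
  refine ⟨⟨[], ?_⟩, ?_, ?_, ?_, ?_⟩
  · refine Set.mem_iInter.2 fun n => ?_
    obtain ⟨s, hs⟩ := (hperf n).1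
    exact (hperf n).2.1 s hs [] List.nil_prefix
  · intro t ht s hst
    exact Set.mem_iInter.2 fun n => (hperf n).2.1 t (Set.mem_iInter.1 ht n) s hst
  · intro t ht
    exact (hperf 0).2.2.1 t (Set.mem_iInter.1 ht 0)
  · intro t ht
    rw [succ_iInter_fusion_eq hh hperf hfus (Nat.lt_succ_self t.length)]
    exact (hperf _).2.2.2.1 t (Set.mem_iInter.1 ht _)
  · intro t ht
    obtain ⟨u, htu, hus, hmin⟩ :=
      (hperf (t.length + 1)).exists_minimal_split (Set.mem_iInter.1 ht _)
    have hu : IsSplitNode h (p (u.length + 1)) u :=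
      isSplitNode_fusion_of_prefixes hfus (Nat.succ_le_succ htu.length_le) hus
        (fun s h1 h2 h3 => Nat.succ_lt_succ (hmin s h1 h2 h3)) (Nat.succ_pos _)
    refine ⟨u, (mem_iInter_fusion_iff hh hperf hfus (Nat.le_succ _)).2 hu.1, htu, ?_⟩
    rw [succ_iInter_fusion_eq hh hperf hfus (Nat.lt_succ_self u.length)]
    exact hu.2
end
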